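/- Let κ > 0. Let v : ℝ → ℝ be measurable with ∫_0^1 v(t)² dt < ∞ and let u : ℝ → ℝ satisfy u(0) = 0 and u(t) = ∫_0^t v(s) ds for all t ∈ [0,1]. Then for every x ∈ (0,1], u(x)²/x ≤ ((1 + √(1+4κ))/(2κ)) · ( ∫_0^1 v(t)² dt + κ·∫_0^1 u(t)²/t² dt ). -/

import Mathlib

open MeasureTheory intervalIntegral

lemma hs_core (v : ℝ → ℝ) (hv1 : IntervalIntegrable v volume 0 1)
    (w : ℝ → ℝ) (hw : w = fun t => ∫ s in (0 : ℝ)..t, v s)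
    (e x : ℝ) (he : 0 < e) (hex : e ≤ x) (hx : x ≤ 1) :
    IntervalIntegrable (fun t => 2 * w t * v t / t - w t ^ 2 / t ^ 2) volume e x ∧
    ∫ t in e..x, (2 * w t * v t / t - w t ^ 2 / t ^ 2) = w x ^ 2 / x - w e ^ 2 / e := by
  have hsub : Set.uIcc e x ⊆ Set.uIcc (0 : ℝ) 1 := by
    rw [Set.uIcc_of_le hex, Set.uIcc_of_le zero_le_one]
    exact Set.Icc_subset_Icc he.le hx
  have hwac : AbsolutelyContinuousOnInterval w e x := by
    rw [hw]
    exact (hv1.absolutelyContinuousOnInterval_intervalIntegral (c := 0) (by simp)).mono hsub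
  have hne : ∀ t ∈ Set.uIcc e x, t ≠ 0 := by
    intro t ht
    rw [Set.uIcc_of_le hex] at ht
    exact (he.trans_le ht.1).ne'
  have hinv : AbsolutelyContinuousOnInterval (fun t : ℝ => t⁻¹) e x :=
    ContDiffOn.absolutelyContinuousOnInterval (contDiffOn_id.inv hne)
  have hF := (hwac.mul hwac).mul hinv
  have hae : ∀ᵐ t, t ∈ Set.uIcc e x →
      deriv (w * w * fun t : ℝ => t⁻¹) t = 2 * w t * v t / t - w t ^ 2 / t ^ 2 := by
    filter_upwards [hv1.ae_hasDerivAt_integral] with t h1 ht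
    have h2 : HasDerivAt w (v t) t := by
      rw [hw]; exact h1 (hsub ht) 0 (by simp)
    have h3 := (h2.mul h2).mul (hasDerivAt_inv (hne t ht))
    rw [h3.deriv]
    have := hne t ht
    simp only [Pi.mul_apply]
    field_simp
    ring
  have hae2 : ∀ᵐ t, t ∈ Set.uIoc e x →
      deriv (w * w * fun t : ℝ => t⁻¹) t = 2 * w t * v t / t - w t ^ 2 / t ^ 2 := by
    filter_upwards [hae] with t h ht using h (Set.uIoc_subset_uIcc ht)
  constructor
  · refine hF.intervalIntegrable_deriv.congr_ae ?_
    exact (ae_restrict_iff' measurableSet_uIoc).2 hae2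
  · rw [← intervalIntegral.integral_congr_ae hae2, hF.integral_deriv_eq_sub]
    simp only [Pi.mul_apply]
    ring

lemma hs_sq_int (v : ℝ → ℝ) (hv1 : IntervalIntegrable v volume 0 1)
    (w : ℝ → ℝ) (hw : w = fun t => ∫ s in (0 : ℝ)..t, v s)
    (e x : ℝ) (he : 0 < e) (hex : e ≤ x) (hx : x ≤ 1) :
    IntervalIntegrable (fun t => w t ^ 2 / t ^ 2) volume e x := by
  have hsub : Set.uIcc e x ⊆ Set.uIcc (0 : ℝ) 1 := by
    rw [Set.uIcc_of_le hex, Set.uIcc_of_le zero_le_one]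
    exact Set.Icc_subset_Icc he.le hx
  have hwc : ContinuousOn w (Set.uIcc e x) := by
    rw [hw]
    exact ((hv1.absolutelyContinuousOnInterval_intervalIntegral
      (c := 0) (by simp)).mono hsub).continuousOn
  apply ContinuousOn.intervalIntegrable
  refine (hwc.pow 2).div (continuousOn_id.pow 2) ?_
  intro t ht
  rw [Set.uIcc_of_le hex] at ht
  exact pow_ne_zero 2 (he.trans_le ht.1).ne'

lemma hs_ineq (v : ℝ → ℝ) (hv1 : IntervalIntegrable v volume 0 1)
    (hv2 : IntervalIntegrable (fun t => v t ^ 2) volume 0 1)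
    (w : ℝ → ℝ) (hw : w = fun t => ∫ s in (0 : ℝ)..t, v s)
    (e x g k : ℝ) (he : 0 < e) (hex : e ≤ x) (hx : x ≤ 1) (hk : g ^ 2 - g ≤ k) :
    g * (w x ^ 2 / x - w e ^ 2 / e) ≤
      (∫ t in e..x, v t ^ 2) + k * ∫ t in e..x, w t ^ 2 / t ^ 2 := by
  obtain ⟨hi, heq⟩ := hs_core v hv1 w hw e x he hex hx
  have hs := hs_sq_int v hv1 w hw e x he hex hx
  have hsub : Set.uIcc e x ⊆ Set.uIcc (0 : ℝ) 1 := by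
    rw [Set.uIcc_of_le hex, Set.uIcc_of_le zero_le_one]
    exact Set.Icc_subset_Icc he.le hx
  have hv2' := hv2.mono_set hsub
  rw [← heq, ← intervalIntegral.integral_const_mul, ← intervalIntegral.integral_const_mul,
    ← intervalIntegral.integral_add hv2' (hs.const_mul k)]
  refine intervalIntegral.integral_mono_on hex (hi.const_mul g) (hv2'.add (hs.const_mul k)) ?_
  intro t ht
  have h1 : 0 ≤ (v t - g * (w t / t)) ^ 2 := sq_nonneg _
  have h2 : 0 ≤ (k - (g ^ 2 - g)) * (w t / t) ^ 2 :=
    mul_nonneg (by linarith) (sq_nonneg _)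
  have h3 : 2 * w t * v t / t = 2 * v t * (w t / t) := by ring
  rw [h3, ← div_pow]
  nlinarith

lemma hs_cs (v : ℝ → ℝ) (hv1 : IntervalIntegrable v volume 0 1)
    (hv2 : IntervalIntegrable (fun t => v t ^ 2) volume 0 1)
    (w : ℝ → ℝ) (hw : w = fun t => ∫ s in (0 : ℝ)..t, v s)
    (e : ℝ) (he : 0 < e) (hx : e ≤ 1) :
    w e ^ 2 / e ≤ ∫ t in (0:ℝ)..e, v t ^ 2 := by
  have hsub : Set.uIcc 0 e ⊆ Set.uIcc (0 : ℝ) 1 := by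
    rw [Set.uIcc_of_le he.le, Set.uIcc_of_le zero_le_one]
    exact Set.Icc_subset_Icc le_rfl hx
  have h1 := hv1.mono_set hsub
  have h2 := hv2.mono_set hsub
  have h : ∫ t in (0:ℝ)..e, ((2 * (w e / e)) * v t - (w e / e) ^ 2) ≤
      ∫ t in (0:ℝ)..e, v t ^ 2 := by
    refine intervalIntegral.integral_mono_on he.le
      ((h1.const_mul _).sub intervalIntegrable_const) h2 ?_
    intro t ht
    nlinarith [sq_nonneg (v t - w e / e)]
  rw [intervalIntegral.integral_sub (h1.const_mul _) intervalIntegrable_const,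
    intervalIntegral.integral_const_mul, intervalIntegral.integral_const] at h
  have h3 : ∫ t in (0:ℝ)..e, v t = w e := by rw [hw]
  rw [h3] at h
  refine le_trans (le_of_eq ?_) h
  simp only [smul_eq_mul]
  field_simp
  ring

lemma hs_hardy (v : ℝ → ℝ) (hv1 : IntervalIntegrable v volume 0 1)
    (hv2 : IntervalIntegrable (fun t => v t ^ 2) volume 0 1)
    (w : ℝ → ℝ) (hw : w = fun t => ∫ s in (0 : ℝ)..t, v s) :
    IntervalIntegrable (fun t => w t ^ 2 / t ^ 2) volume 0 1 := by
  rw [intervalIntegrable_iff_integrableOn_Ioc_of_le zero_le_one]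
  have hpos : ∀ n : ℕ, (0:ℝ) < 1 / ((n:ℝ) + 1) := fun n => by positivity
  have hle : ∀ n : ℕ, 1 / ((n:ℝ) + 1) ≤ 1 := fun n => by
    rw [div_le_one (by positivity)]; linarith [(Nat.cast_nonneg n : (0:ℝ) ≤ n)]
  refine integrableOn_Ioc_of_intervalIntegral_norm_bounded_left
    (a := fun n : ℕ => 1 / ((n:ℝ) + 1)) (l := Filter.atTop)
    (I := 6 * ∫ t in (0:ℝ)..1, v t ^ 2) ?_ tendsto_one_div_add_atTop_nhds_zero_nat ?_
  · intro n
    rw [← intervalIntegrable_iff_integrableOn_Ioc_of_le (hle n)]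
    exact hs_sq_int v hv1 w hw _ 1 (hpos n) (hle n) le_rfl
  · refine Filter.Eventually.of_forall fun n => ?_
    have hp := hpos n
    have hl := hle n
    generalize 1 / ((n:ℝ) + 1) = e at hp hl ⊢
    rw [← intervalIntegral.integral_of_le hl]
    have h1 := hs_ineq v hv1 hv2 w hw e 1 (1/2) (-1/4) hp hl le_rfl (by norm_num)
    have h2 := hs_cs v hv1 hv2 w hw e hp hl
    have hsub : Set.uIcc 0 e ⊆ Set.uIcc (0 : ℝ) 1 := by
      rw [Set.uIcc_of_le hp.le, Set.uIcc_of_le zero_le_one]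
      exact Set.Icc_subset_Icc le_rfl hl
    have hsub' : Set.uIcc e 1 ⊆ Set.uIcc (0 : ℝ) 1 := by
      rw [Set.uIcc_of_le hl, Set.uIcc_of_le zero_le_one]
      exact Set.Icc_subset_Icc hp.le le_rfl
    have h3 := intervalIntegral.integral_add_adjacent_intervals
      (hv2.mono_set hsub) (hv2.mono_set hsub')
    have h4 : 0 ≤ ∫ t in (0:ℝ)..e, v t ^ 2 :=
      intervalIntegral.integral_nonneg hp.le fun t _ => sq_nonneg _
    have h5 : 0 ≤ ∫ t in e..1, v t ^ 2 :=
      intervalIntegral.integral_nonneg hl fun t _ => sq_nonneg _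
    have h6 : (fun t => ‖w t ^ 2 / t ^ 2‖) = fun t => w t ^ 2 / t ^ 2 := by
      ext t
      exact Real.norm_of_nonneg (by positivity)
    rw [h6]
    have h7 : 0 ≤ w 1 ^ 2 / 1 := by positivity
    linarith

theorem hardy_sobolev_unit_interval (κ : ℝ) (hκ : 0 < κ)
    (v : ℝ → ℝ) (hv : Measurable v)
    (hv2 : IntervalIntegrable (fun t => v t ^ 2) volume 0 1)
    (u : ℝ → ℝ) (hu0 : u 0 = 0)
    (hu : ∀ t ∈ Set.Icc (0 : ℝ) 1, u t = ∫ s in (0 : ℝ)..t, v s) :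
    ∀ x ∈ Set.Ioc (0 : ℝ) 1,
      u x ^ 2 / x ≤
        ((1 + Real.sqrt (1 + 4 * κ)) / (2 * κ)) *
          ((∫ t in (0 : ℝ)..1, v t ^ 2) + κ * ∫ t in (0 : ℝ)..1, u t ^ 2 / t ^ 2) := by
  intro x hx
  have hv1 : IntervalIntegrable v volume 0 1 := by
    refine (intervalIntegrable_const (c := (1:ℝ)).add hv2).mono_fun
      hv.aestronglyMeasurable (Filter.Eventually.of_forall fun t => ?_)
    simp only [Real.norm_eq_abs]
    refine le_trans ?_ (le_abs_self _)
    show |v t| ≤ 1 + v t ^ 2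
    rw [← sq_abs]
    nlinarith [sq_nonneg (|v t| - 1), abs_nonneg (v t)]
  obtain ⟨w, hw⟩ : ∃ w : ℝ → ℝ, w = fun t => ∫ s in (0 : ℝ)..t, v s := ⟨_, rfl⟩
  have huw : ∀ t ∈ Set.Icc (0 : ℝ) 1, u t = w t := by rw [hw]; exact hu
  have hint : ∫ t in (0 : ℝ)..1, u t ^ 2 / t ^ 2 = ∫ t in (0 : ℝ)..1, w t ^ 2 / t ^ 2 := by
    apply intervalIntegral.integral_congr
    intro t ht
    rw [Set.uIcc_of_le zero_le_one] at ht
    simp only [huw t ht]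
  rw [hint, huw x ⟨hx.1.le, hx.2⟩]
  have hh := hs_hardy v hv1 hv2 w hw
  set s := Real.sqrt (1 + 4 * κ) with hs
  have hs2 : s ^ 2 = 1 + 4 * κ := Real.sq_sqrt (by linarith)
  have hs0 : 0 ≤ s := Real.sqrt_nonneg _
  have hs1 : 1 < s := by nlinarith
  set E := (∫ t in (0 : ℝ)..1, v t ^ 2) + κ * ∫ t in (0 : ℝ)..1, w t ^ 2 / t ^ 2 with hE
  have key : (s - 1) / 2 * (w x ^ 2 / x) ≤ E := by
    have hcont : Filter.Tendsto (fun e => E + (s - 1) / 2 * ∫ t in (0:ℝ)..e, v t ^ 2)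
        (nhdsWithin 0 (Set.Ioo 0 x)) (nhds (E + (s - 1) / 2 * 0)) := by
      refine tendsto_const_nhds.add (Filter.Tendsto.const_mul _ ?_)
      have hc := (hv2.absolutelyContinuousOnInterval_intervalIntegral
        (c := 0) (by simp)).continuousOn 0 (by simp)
      have hc' := hc.tendsto
      simp only [intervalIntegral.integral_same] at hc'
      refine hc'.mono_left (nhdsWithin_mono _ ?_)
      rw [Set.uIcc_of_le zero_le_one]
      exact fun t ht => ⟨ht.1.le, ht.2.le.trans hx.2⟩
    rw [mul_zero, add_zero] at hcont
    have : (nhdsWithin (0:ℝ) (Set.Ioo 0 x)).NeBot := left_nhdsWithin_Ioo_neBot hx.1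
    refine ge_of_tendsto hcont ?_
    filter_upwards [self_mem_nhdsWithin] with e he
    have h1 := hs_ineq v hv1 hv2 w hw e x ((s-1)/2) κ he.1 he.2.le hx.2 (by nlinarith)
    have h2 := hs_cs v hv1 hv2 w hw e he.1 (he.2.le.trans hx.2)
    have h3 : ∫ t in e..x, v t ^ 2 ≤ ∫ t in (0:ℝ)..1, v t ^ 2 :=
      intervalIntegral.integral_mono_interval he.1.le he.2.le hx.2
        (Filter.Eventually.of_forall fun t => sq_nonneg _) hv2
    have h4 : ∫ t in e..x, w t ^ 2 / t ^ 2 ≤ ∫ t in (0:ℝ)..1, w t ^ 2 / t ^ 2 :=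
      intervalIntegral.integral_mono_interval he.1.le he.2.le hx.2
        (Filter.Eventually.of_forall fun t => by
          show 0 ≤ w t ^ 2 / t ^ 2
          positivity) hh
    have h5 := mul_le_mul_of_nonneg_left h4 hκ.le
    have h6 := mul_le_mul_of_nonneg_left h2 (by linarith : 0 ≤ (s - 1) / 2)
    rw [mul_sub] at h1
    linarith
  have hc : (1 + s) / (2 * κ) * ((s - 1) / 2) = 1 := by
    field_simp
    nlinarith
  calc w x ^ 2 / x = (1 + s) / (2 * κ) * ((s - 1) / 2 * (w x ^ 2 / x)) := by
        rw [← mul_assoc, hc, one_mul]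
    _ ≤ _ := mul_le_mul_of_nonneg_left key (by positivity)
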